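/- arXiv:1604.04448 — 2 statements merged into one kernel-verified Lean document; each statement's English description precedes it below -/
import Mathlib

section
/- Let Γ' = B'(d, ℓ) be the modified De Bruijn digraph obtained from B(d, ℓ) by choosing fixed symbols x₁,…,x_{ℓ−1} ∈ ℤ_d not all equal, letting X = {x₁…x_{ℓ−1}k : k ∈ ℤ_d}, choosing permutations α_j of ℤ_d for each j ∈ ℤ_d, and redefining the out-neighbors of each vertex x₁…x_{ℓ−1}k ∈ X to be the d vertices x₂…x_{ℓ−1} α_j(k) j for j ∈ ℤ_d. Then Γ' is d-regular and ℓ-reachable: between any ordered pair of vertices of Γ' there exists a walk of length exactly ℓ; in particular Γ' has diameter ℓ. -/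
open scoped Classical

/-- Adjacency of the De Bruijn digraph `B(d, ℓ)`. -/
def deBruijnAdj (d ℓ : ℕ) (x y : Fin ℓ → Fin d) : Prop :=
  ∀ i : Fin ℓ, ∀ h : i.val + 1 < ℓ, x ⟨i.val + 1, h⟩ = y ⟨i.val, Nat.lt_of_succ_lt h⟩

/-- A directed walk of length `ℓ` from `u` to `v`. -/
def DigraphWalk {V : Type*} (E : V → V → Prop) : ℕ → V → V → Prop
  | 0, u, v => u = v
  | (n + 1), u, v => ∃ w, E u w ∧ DigraphWalk E n w v

theorem aux_card {V : Type*} [Fintype V] {d : ℕ} (p : V → Prop) [DecidablePred p]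
    (g : Fin d → V) (f : V → Fin d) (h1 : ∀ a, p (g a)) (h2 : ∀ a, f (g a) = a)
    (h3 : ∀ v, p v → v = g (f v)) : (Finset.univ.filter p).card = d := by
  have : (Finset.univ.filter p).card = (Finset.univ : Finset (Fin d)).card := by
    symm
    apply Finset.card_bij (fun a _ => g a)
    · intro a _
      simp [h1]
    · intro a _ b _ hab
      rw [← h2 a, ← h2 b, hab]
    · intro v hv
      exact ⟨f v, Finset.mem_univ _, (h3 v (by simpa using hv)).symm⟩
  simpa using this

theorem aux_back {A : Type*} (a : A) (n : ℕ) : ∀ f : ℕ → A → A,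
    ∃ k : ℕ → A, k n = a ∧ ∀ i < n, k i = f i (k (i + 1)) := by
  induction n with
  | zero => exact fun f => ⟨fun _ => a, rfl, by simp⟩
  | succ n ih =>
    intro f
    obtain ⟨k, hk, hk'⟩ := ih (fun i => f (i + 1))
    refine ⟨fun i => Nat.casesOn i (f 0 (k 0)) k, hk, ?_⟩
    intro i hi
    cases i with
    | zero => rfl
    | succ i => exact hk' i (by omega)

theorem aux_walk {V : Type*} (E : V → V → Prop) (n : ℕ) : ∀ w : ℕ → V,
    (∀ i < n, E (w i) (w (i + 1))) → DigraphWalk E n (w 0) (w n) := by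
  induction n with
  | zero => exact fun w _ => rfl
  | succ n ih =>
    intro w hw
    exact ⟨w 1, hw 0 (by omega), ih (fun i => w (i + 1)) (fun i hi => hw (i + 1) (by omega))⟩

theorem aux_count {V : Type*} [Fintype V] (E : V → V → Prop) (d : ℕ)
    (h : ∀ u, (Finset.univ.filter (fun v => E u v)).card = d) (n : ℕ) : ∀ u,
    (Finset.univ.filter (fun v => DigraphWalk E n u v)).card ≤ d ^ n := by
  induction n with
  | zero =>
    intro u
    rw [pow_zero]
    apply Finset.card_le_one.2
    intro a ha b hb
    have ha' : u = a := (Finset.mem_filter.1 ha).2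
    have hb' : u = b := (Finset.mem_filter.1 hb).2
    rw [← ha', ← hb']
  | succ n ih =>
    intro u
    have hsub : (Finset.univ.filter (fun v => DigraphWalk E (n + 1) u v)) ⊆
        (Finset.univ.filter (fun v => E u v)).biUnion
          (fun w => Finset.univ.filter (fun v => DigraphWalk E n w v)) := by
      intro v hv
      obtain ⟨w, h1, h2⟩ := (Finset.mem_filter.1 hv).2
      exact Finset.mem_biUnion.2 ⟨w, Finset.mem_filter.2 ⟨Finset.mem_univ _, h1⟩,
        Finset.mem_filter.2 ⟨Finset.mem_univ _, h2⟩⟩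
    calc _ ≤ _ := Finset.card_le_card hsub
      _ ≤ (Finset.univ.filter (fun v => E u v)).card * d ^ n :=
        Finset.card_biUnion_le_card_mul _ _ _ (fun w _ => ih w)
      _ = d ^ (n + 1) := by rw [h, pow_succ, mul_comm]

theorem aux_far {V : Type*} [Fintype V] (E : V → V → Prop) (d l : ℕ) (hd : 2 ≤ d)
    (hV : Fintype.card V = d ^ l)
    (h : ∀ u, (Finset.univ.filter (fun v => E u v)).card = d) (u : V) :
    ∃ v, ∀ m < l, ¬ DigraphWalk E m u v := by
  by_contra! hc
  have hsub : (Finset.univ : Finset V) ⊆ (Finset.range l).biUnion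
      (fun m => Finset.univ.filter (fun v => DigraphWalk E m u v)) := by
    intro v _
    simpa using hc v
  have h1 := Finset.card_le_card hsub
  have h2 : ((Finset.range l).biUnion
      (fun m => Finset.univ.filter (fun v => DigraphWalk E m u v))).card ≤
      ∑ m ∈ Finset.range l, d ^ m :=
    Finset.card_biUnion_le.trans (Finset.sum_le_sum fun m _ => aux_count E d h m u)
  have h3 : ∑ m ∈ Finset.range l, d ^ m < d ^ l :=
    Nat.geomSum_lt hd (by simp)
  rw [Finset.card_univ, hV] at h1
  omega

/-- the modified De Bruijn digraph `B'(d, ℓ)`.  Fix symbols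
`x₁ … x_{ℓ-1}` (the values `xs i` for `i < ℓ - 1`), not all equal, let
`X = {x₁…x_{ℓ-1}k : k ∈ ℤ_d}`, and fix permutations `α_j` of `ℤ_d`.  The modified
digraph `E'` agrees with `B(d, ℓ)` on vertices outside `X`, while each vertex
`x₁…x_{ℓ-1}k ∈ X` is adjacent exactly to the `d` vertices `x₂…x_{ℓ-1} α_j(k) j`,
`j ∈ ℤ_d`.  Then `E'` is `d`-regular, `ℓ`-reachable (a walk of length exactly `ℓ`
between every ordered pair), and has diameter `ℓ`. -/
theorem stmt17 (d ℓ : ℕ) (hd : 2 ≤ d) (hℓ : 3 ≤ ℓ)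
    (xs : Fin ℓ → Fin d)
    (hxs : ∃ i j : Fin ℓ, i.val + 1 < ℓ ∧ j.val + 1 < ℓ ∧ xs i ≠ xs j)
    (α : Fin d → Equiv.Perm (Fin d))
    (X : Set (Fin ℓ → Fin d))
    (hX : X = {u : Fin ℓ → Fin d | ∀ i : Fin ℓ, i.val + 1 < ℓ → u i = xs i})
    (E' : (Fin ℓ → Fin d) → (Fin ℓ → Fin d) → Prop)
    -- out of `X`, the arcs are those of `B(d, ℓ)`
    (hE'out : ∀ u v, u ∉ X → (E' u v ↔ deBruijnAdj d ℓ u v))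
    -- on `X`, vertex `x₁…x_{ℓ-1}k` is adjacent exactly to the words
    -- `x₂…x_{ℓ-1} (α_j k) j` for `j ∈ ℤ_d`
    (hE'in : ∀ u v, u ∈ X →
      (E' u v ↔ ((∀ i : Fin ℓ, ∀ h : i.val + 2 < ℓ,
            v ⟨i.val, by omega⟩ = u ⟨i.val + 1, by omega⟩) ∧
          v ⟨ℓ - 2, by omega⟩ =
            α (v ⟨ℓ - 1, by omega⟩) (u ⟨ℓ - 1, by omega⟩)))) :
    (∀ u : Fin ℓ → Fin d,
      (Finset.univ.filter (fun v => E' u v)).card = d ∧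
      (Finset.univ.filter (fun v => E' v u)).card = d) ∧
    (∀ u v : Fin ℓ → Fin d, DigraphWalk E' ℓ u v) ∧
    (∃ u v : Fin ℓ → Fin d, ∀ m < ℓ, ¬ DigraphWalk E' m u v) := by
  have hXm : ∀ u, u ∈ X ↔ ∀ i (h : i + 1 < ℓ), u ⟨i, by omega⟩ = xs ⟨i, by omega⟩ := by
    intro u
    rw [hX]
    exact ⟨fun h i hi => h ⟨i, by omega⟩ hi, fun h i hi => h i.1 hi⟩
  have hE : ∀ u v, E' u v ↔ ((∀ i, ∀ h : i + 2 < ℓ,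
      v ⟨i, by omega⟩ = u ⟨i + 1, by omega⟩) ∧
      v ⟨ℓ - 2, by omega⟩ = if u ∈ X then
        α (v ⟨ℓ - 1, by omega⟩) (u ⟨ℓ - 1, by omega⟩) else u ⟨ℓ - 1, by omega⟩) := by
    intro u v
    by_cases hu : u ∈ X
    · rw [hE'in u v hu, if_pos hu]
      exact ⟨fun h => ⟨fun i hi => h.1 ⟨i, by omega⟩ hi, h.2⟩,
        fun h => ⟨fun i hi => h.1 i.1 hi, h.2⟩⟩
    · rw [hE'out u v hu, if_neg hu]
      constructor
      · intro h
        refine ⟨fun i hi => (h ⟨i, by omega⟩ (by simp; omega)).symm, ?_⟩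
        have := h ⟨ℓ - 2, by omega⟩ (by simp; omega)
        rw [← this]
        congr 2
        simp; omega
      · rintro ⟨h, h'⟩ ⟨i, hi⟩ hi'
        simp only at hi' ⊢
        by_cases h2 : i + 2 < ℓ
        · exact (h i h2).symm
        · obtain rfl : i = ℓ - 2 := by omega
          rw [h']
          congr 2
          omega
  clear hE'in hE'out hX
  have hext : ∀ u v : Fin ℓ → Fin d, (∀ i (h : i + 1 < ℓ), u ⟨i, by omega⟩ = v ⟨i, by omega⟩) →
      u ⟨ℓ - 1, by omega⟩ = v ⟨ℓ - 1, by omega⟩ → u = v := by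
    intro u v h h'
    funext ⟨i, hi⟩
    by_cases h2 : i + 1 < ℓ
    · exact h i h2
    · obtain rfl : i = ℓ - 1 := by omega
      exact h'
  have hout : ∀ u : Fin ℓ → Fin d, (Finset.univ.filter (fun v => E' u v)).card = d := by
    intro u
    apply aux_card (fun v => E' u v)
      (fun j i => if h : i.1 + 2 < ℓ then u ⟨i.1 + 1, by omega⟩ else
        if i.1 + 1 < ℓ then (if u ∈ X then α j (u ⟨ℓ - 1, by omega⟩) else u ⟨ℓ - 1, by omega⟩)
        else j) (fun v => v ⟨ℓ - 1, by omega⟩)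
    · intro a
      rw [hE]
      refine ⟨fun i hi => by simp [hi], ?_⟩
      have e1 : ¬ (ℓ - 2 + 2 < ℓ) := by omega
      have e2 : (ℓ - 2 + 1 < ℓ) := by omega
      have e3 : ¬ (ℓ - 1 + 2 < ℓ) := by omega
      have e4 : ¬ (ℓ - 1 + 1 < ℓ) := by omega
      simp only [e1, e2, e3, e4, dite_false, if_true, if_false]
    · intro a
      have e3 : ¬ (ℓ - 1 + 2 < ℓ) := by omega
      have e4 : ¬ (ℓ - 1 + 1 < ℓ) := by omega
      simp only [e3, e4, dite_false, if_false]
    · intro v hv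
      rw [hE] at hv
      obtain ⟨h1, h2⟩ := hv
      apply hext
      · intro i hi
        by_cases h3 : i + 2 < ℓ
        · simp only [h3, dite_true]
          exact h1 i h3
        · obtain rfl : i = ℓ - 2 := by omega
          simp only [h3, hi, dite_false, if_true]
          exact h2
      · have e3 : ¬ (ℓ - 1 + 2 < ℓ) := by omega
        have e4 : ¬ (ℓ - 1 + 1 < ℓ) := by omega
        simp only [e3, e4, dite_false, if_false]
  have hin : ∀ u : Fin ℓ → Fin d, (Finset.univ.filter (fun v => E' v u)).card = d := by
    intro w
    let c : Fin d → Fin ℓ → Fin d := fun a i => if i.1 = 0 then a else w ⟨i.1 - 1, by omega⟩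
    let g : Fin d → Fin ℓ → Fin d := fun a i => if i.1 + 1 < ℓ then c a i else
      if c a ∈ X then (α (w ⟨ℓ - 1, by omega⟩)).symm (w ⟨ℓ - 2, by omega⟩)
      else w ⟨ℓ - 2, by omega⟩
    have hg1 : ∀ a i (h : i + 1 < ℓ), g a ⟨i, by omega⟩ = c a ⟨i, by omega⟩ := by
      intro a i h
      simp only [g, h, if_true]
    have hg2 : ∀ a, g a ⟨ℓ - 1, by omega⟩ = if c a ∈ X then
        (α (w ⟨ℓ - 1, by omega⟩)).symm (w ⟨ℓ - 2, by omega⟩) else w ⟨ℓ - 2, by omega⟩ := by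
      intro a
      have e4 : ¬ (ℓ - 1 + 1 < ℓ) := by omega
      simp only [g, e4, if_false]
    have hXc : ∀ u v : Fin ℓ → Fin d,
        (∀ i (h : i + 1 < ℓ), u ⟨i, by omega⟩ = v ⟨i, by omega⟩) → (u ∈ X ↔ v ∈ X) := by
      intro u v h
      rw [hXm, hXm]
      exact forall₂_congr fun i hi => by rw [h i hi]
    apply aux_card (fun v => E' v w) g (fun v => v ⟨0, by omega⟩)
    · intro a
      rw [hE]
      refine ⟨fun i hi => ?_, ?_⟩
      · rw [hg1 _ _ (by omega)]
        simp [c]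
      · rw [hg2]
        simp only [hXc (g a) (c a) (hg1 a)]
        by_cases h : c a ∈ X <;> simp [h]
    · intro a
      rw [hg1 _ _ (by omega)]
      simp [c]
    · intro v hv
      rw [hE] at hv
      obtain ⟨h1, h2⟩ := hv
      have hvc : ∀ i (h : i + 1 < ℓ),
          v ⟨i, by omega⟩ = c (v ⟨0, by omega⟩) ⟨i, by omega⟩ := by
        intro i hi
        cases i with
        | zero => simp [c]
        | succ i => simp [c, h1 i (by omega)]
      apply hext
      · intro i hi
        rw [hg1 _ _ hi]
        exact hvc i hi
      · rw [hg2]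
        simp only [hXc v (c (v ⟨0, by omega⟩)) hvc] at h2
        rw [h2]
        by_cases h : c (v ⟨0, by omega⟩) ∈ X <;> simp [h]
  refine ⟨fun u => ⟨hout u, hin u⟩, ?_, ?_⟩
  · intro u v
    let u' : Fin d := if u ∈ X then α (v ⟨0, by omega⟩) (u ⟨ℓ - 1, by omega⟩)
      else u ⟨ℓ - 1, by omega⟩
    let z : ℕ → Fin d := fun n => if h : n + 1 < ℓ then u ⟨n, by omega⟩ else
      if n < ℓ then u' else if h : n - ℓ < ℓ then v ⟨n - ℓ, h⟩ else u'
    have z1 : ∀ n (h : n + 1 < ℓ), z n = u ⟨n, by omega⟩ := by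
      intro n h
      simp only [z, h, dite_true]
    have z2 : z (ℓ - 1) = u' := by
      have e1 : ¬ (ℓ - 1 + 1 < ℓ) := by omega
      have e2 : (ℓ - 1 < ℓ) := by omega
      simp only [z, e1, e2, dite_false, if_true]
    have z3 : ∀ n (h : n < ℓ), z (ℓ + n) = v ⟨n, h⟩ := by
      intro n h
      have e1 : ¬ (ℓ + n + 1 < ℓ) := by omega
      have e2 : ¬ (ℓ + n < ℓ) := by omega
      have e3 : ℓ + n - ℓ = n := by omega
      simp only [z, e1, e2, e3, h, dite_false, if_false, dite_true]
    let P : ℕ → Prop := fun i => ∀ t (h : t + 1 < ℓ), z (i + t) = xs ⟨t, by omega⟩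
    obtain ⟨k, hk, hk'⟩ := aux_back (z (ℓ + (ℓ - 1))) ℓ
      (fun i b => if P i then (α b).symm (z (i + (ℓ - 1))) else z (i + (ℓ - 1)))
    let w : ℕ → Fin ℓ → Fin d := fun i t => if t.1 + 1 < ℓ then z (i + t.1) else k i
    have w1 : ∀ i t (h : t + 1 < ℓ), w i ⟨t, by omega⟩ = z (i + t) := by
      intro i t h
      simp only [w, h, if_true]
    have w2 : ∀ i, w i ⟨ℓ - 1, by omega⟩ = k i := by
      intro i
      have e1 : ¬ (ℓ - 1 + 1 < ℓ) := by omega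
      simp only [w, e1, if_false]
    have hPX : ∀ i, w i ∈ X ↔ P i := by
      intro i
      rw [hXm]
      exact forall₂_congr fun t ht => by rw [w1 i t ht]
    have hP0 : P 0 ↔ u ∈ X := by
      rw [hXm]
      exact forall₂_congr fun t ht => by rw [zero_add, z1 t ht]
    have hP1 : u ∈ X → ¬ P 1 := by
      intro h0 h1
      rw [← hP0] at h0
      have hc : ∀ t (h : t + 1 < ℓ), xs ⟨t, by omega⟩ = xs ⟨0, by omega⟩ := by
        intro t
        induction t with
        | zero => intro _; rfl
        | succ t ih =>
          intro h
          rw [← ih (by omega), ← h1 t (by omega), ← h0 (t + 1) h]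
          congr 1
          omega
      obtain ⟨i, j, hi, hj, hij⟩ := hxs
      exact hij ((hc i.1 hi).trans (hc j.1 hj).symm)
    have hw0 : w 0 = u := by
      apply hext
      · intro i hi
        rw [w1 0 i hi, zero_add, z1 i hi]
      · rw [w2, hk' 0 (by omega), zero_add, zero_add, z2]
        by_cases hu : u ∈ X
        · rw [if_pos (hP0.2 hu), hk' 1 (by omega), if_neg (hP1 hu)]
          have e : 1 + (ℓ - 1) = ℓ + 0 := by omega
          rw [e, z3 0 (by omega)]
          simp [u', hu]
        · rw [if_neg (fun h => hu (hP0.1 h))]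
          simp [u', hu]
    have hwl : w ℓ = v := by
      apply hext
      · intro i hi
        rw [w1 ℓ i hi, z3 i (by omega)]
      · rw [w2, hk, z3 _ (by omega)]
    have := aux_walk E' ℓ w (by
      intro i hi
      rw [hE]
      refine ⟨fun t ht => ?_, ?_⟩
      · rw [w1 _ _ (by omega), w1 _ _ (by omega)]
        congr 1
        omega
      · rw [w1 _ _ (by omega), w2, w2]
        have e : i + 1 + (ℓ - 2) = i + (ℓ - 1) := by omega
        rw [e, hk' i hi]
        simp only [hPX]
        by_cases h : P i <;> simp [h])
    rwa [hw0, hwl] at this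
  · exact ⟨xs, aux_far E' d ℓ hd (by simp) hout xs⟩
end

section
/- The modified De Bruijn digraph B'(2,3), obtained from B(2,3) by replacing the arcs 100 → 001 and 101 → 011 with the arcs 100 → 011 and 101 → 001, is cospectral with B(2,3): both have characteristic polynomial x⁷(x − 2), i.e., spectrum {0⁷, 2¹}. -/
open scoped Classical
open Polynomial

/-- Adjacency of the modified De Bruijn digraph `B'(2,3)`: the arcs `100 → 001` and
`101 → 011` of `B(2,3)` are replaced by `100 → 011` and `101 → 001`. -/
def modifiedB23Adj (x y : Fin 3 → Fin 2) : Prop :=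
  (deBruijnAdj 2 3 x y ∧
    ¬ ((x = ![1,0,0] ∧ y = ![0,0,1]) ∨ (x = ![1,0,1] ∧ y = ![0,1,1]))) ∨
  (x = ![1,0,0] ∧ y = ![0,1,1]) ∨ (x = ![1,0,1] ∧ y = ![0,0,1])

def matM : Matrix (Fin 8) (Fin 8) ℤ :=
  !![1, 1, 0, 0, 0, 0, 0, 0;
     0, 0, 1, 1, 0, 0, 0, 0;
     0, 0, 0, 0, 1, 1, 0, 0;
     0, 0, 0, 0, 0, 0, 1, 1;
     1, 1, 0, 0, 0, 0, 0, 0;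
     0, 0, 1, 1, 0, 0, 0, 0;
     0, 0, 0, 0, 1, 1, 0, 0;
     0, 0, 0, 0, 0, 0, 1, 1]

def matMP : Matrix (Fin 8) (Fin 8) ℤ :=
  !![-1, 0, 0, 0, -1, 0, -1, 1;
     1, 0, 0, 0, 0, 0, 0, 0;
     0, -1, 0, 0, 1, 0, 0, 0;
     0, 1, 0, 0, 0, 0, 0, 0;
     0, 0, -1, 0, 0, -1, 1, 0;
     0, 0, 1, 0, 0, 0, 0, 0;
     0, 0, 0, -1, 0, 1, 0, 0;
     0, 0, 0, 1, 0, 0, 0, 0]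

def matMQ : Matrix (Fin 8) (Fin 8) ℤ :=
  !![0, 1, 0, 0, 0, 0, 0, 0;
     0, 0, 0, 1, 0, 0, 0, 0;
     0, 0, 0, 0, 0, 1, 0, 0;
     0, 0, 0, 0, 0, 0, 0, 1;
     0, 0, 1, 1, 0, 0, 0, 0;
     0, 0, 0, 0, 0, 0, 1, 1;
     0, 0, 0, 0, 1, 1, 1, 1;
     1, 1, 1, 1, 1, 1, 1, 1]

def matMT : Matrix (Fin 8) (Fin 8) ℤ :=
  !![0, 0, 0, 0, 1, 0, 0, 0;
     0, 0, 0, 0, 0, 1, 0, 0;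
     0, 0, 0, 0, 1, 0, 0, 0;
     0, 0, 0, 0, 0, 1, 0, 0;
     0, 0, 0, 0, 0, 0, 1, 0;
     0, 0, 0, 0, 0, 0, 1, 0;
     0, 0, 0, 0, 0, 0, 0, 1;
     0, 0, 0, 0, 0, 0, 0, 2]

def matN : Matrix (Fin 8) (Fin 8) ℤ :=
  !![1, 1, 0, 0, 0, 0, 0, 0;
     0, 0, 1, 1, 0, 0, 0, 0;
     0, 0, 0, 0, 1, 1, 0, 0;
     0, 0, 0, 0, 0, 0, 1, 1;
     1, 0, 0, 1, 0, 0, 0, 0;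
     0, 1, 1, 0, 0, 0, 0, 0;
     0, 0, 0, 0, 1, 1, 0, 0;
     0, 0, 0, 0, 0, 0, 1, 1]

def matNP : Matrix (Fin 8) (Fin 8) ℤ :=
  !![-1, 0, 0, -1, -1, -1, -1, 1;
     1, 0, 0, 1, 0, 0, 0, 0;
     -1, 0, 0, 0, 1, 1, 0, 0;
     1, 0, 0, 0, 0, 0, 0, 0;
     0, -1, 0, 0, -1, 0, 1, 0;
     0, 1, 0, 0, 0, 0, 0, 0;
     0, 0, -1, 0, 1, 0, 0, 0;
     0, 0, 1, 0, 0, 0, 0, 0]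

def matNQ : Matrix (Fin 8) (Fin 8) ℤ :=
  !![0, 0, 0, 1, 0, 0, 0, 0;
     0, 0, 0, 0, 0, 1, 0, 0;
     0, 0, 0, 0, 0, 0, 0, 1;
     0, 1, 0, -1, 0, 0, 0, 0;
     0, 0, 0, 0, 0, 0, 1, 1;
     0, 0, 1, 1, 0, 0, -1, -1;
     0, 0, 0, 0, 1, 1, 1, 1;
     1, 1, 1, 1, 1, 1, 1, 1]

def matNT : Matrix (Fin 8) (Fin 8) ℤ :=
  !![0, 0, 0, 0, 1, 0, 0, 0;
     0, 0, 0, 1, 1, 1, 0, 0;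
     0, 0, 0, 0, 1, 0, 0, 0;
     0, 0, 0, 0, 0, 1, 0, 0;
     0, 0, 0, 0, 0, 0, 1, 0;
     0, 0, 0, 0, 0, 0, 0, 0;
     0, 0, 0, 0, 0, 0, 0, 1;
     0, 0, 0, 0, 0, 0, 0, 2]

lemma charpoly_of_triangularized (M P Q T : Matrix (Fin 8) (Fin 8) ℤ)
    (hPQ : P * Q = 1) (hMP : M * P = P * T)
    (hT : ∀ i j : Fin 8, (if j < i then T i j else 0) = 0)
    (hd : ∀ i : Fin 8, T i i = if i = 7 then 2 else 0) :
    M.charpoly = X ^ 7 * (X - C 2) := by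
  have hQP : Q * P = 1 := mul_eq_one_comm.mp hPQ
  have h1 : M = P * (T * Q) := by
    rw [← mul_assoc, ← hMP, mul_assoc, hPQ, mul_one]
  rw [h1, Matrix.charpoly_mul_comm, mul_assoc, hQP, mul_one,
    Matrix.charpoly_of_isUpperTriangular T (fun i j h => by simpa [show j < i from h] using hT i j)]
  simp only [hd]
  simp [Fin.prod_univ_eight]
  left
  ring

/-- The `i`-th binary word of length 3. -/
def word (i : Fin 8) : Fin 3 → Fin 2 :=
  ![![0,0,0], ![0,0,1], ![0,1,0], ![0,1,1], ![1,0,0], ![1,0,1], ![1,1,0], ![1,1,1]] i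

lemma word_bijective : Function.Bijective word := by
  unfold Function.Bijective Function.Injective Function.Surjective
  decide

lemma charpoly_transfer (A : Matrix (Fin 3 → Fin 2) (Fin 3 → Fin 2) ℝ)
    (M : Matrix (Fin 8) (Fin 8) ℤ) (h : ∀ i j, A (word i) (word j) = (M i j : ℝ))
    (hM : M.charpoly = X ^ 7 * (X - C 2)) :
    A.charpoly = X ^ 7 * (X - C 2) := by
  have h1 : Matrix.reindex (Equiv.ofBijective word word_bijective).symm
      (Equiv.ofBijective word word_bijective).symm A = M.map (Int.castRingHom ℝ) := by
    ext i j
    simp [h]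
  rw [← Matrix.charpoly_reindex (Equiv.ofBijective word word_bijective).symm A, h1,
    Matrix.charpoly_map, hM]
  simp
  exact (map_ofNat C 2).symm

lemma deBruijnAdj_iff (x y : Fin 3 → Fin 2) :
    deBruijnAdj 2 3 x y ↔ x 1 = y 0 ∧ x 2 = y 1 := by
  constructor
  · intro h
    exact ⟨h 0 (by decide), h 1 (by decide)⟩
  · rintro ⟨h0, h1⟩ i hi
    fin_cases i
    · exact h0
    · exact h1
    · exact absurd hi (by decide)

lemma entry_base : ∀ i j : Fin 8,
    (deBruijnAdj 2 3 (word i) (word j) ∧ matM i j = 1) ∨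
    (¬ deBruijnAdj 2 3 (word i) (word j) ∧ matM i j = 0) := by
  intro i j
  rw [deBruijnAdj_iff]
  fin_cases i <;> fin_cases j <;> simp [word, matM]

lemma entry_mod : ∀ i j : Fin 8,
    (modifiedB23Adj (word i) (word j) ∧ matN i j = 1) ∨
    (¬ modifiedB23Adj (word i) (word j) ∧ matN i j = 0) := by
  intro i j
  rw [modifiedB23Adj, deBruijnAdj_iff]
  fin_cases i <;> fin_cases j <;> simp [word, matN]

/-- `B(2,3)` and the modified De Bruijn digraph `B'(2,3)` are cospectral:
both adjacency matrices have characteristic polynomial `x⁷(x - 2)`, i.e. spectrum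
`{0⁷, 2¹}`. -/
theorem stmt18
    (A A' : Matrix (Fin 3 → Fin 2) (Fin 3 → Fin 2) ℝ)
    (hA : ∀ x y, A x y = if deBruijnAdj 2 3 x y then 1 else 0)
    (hA' : ∀ x y, A' x y = if modifiedB23Adj x y then 1 else 0) :
    A.charpoly = X ^ 7 * (X - C 2) ∧ A'.charpoly = X ^ 7 * (X - C 2) := by
  constructor
  · refine charpoly_transfer A matM (fun i j => ?_)
      (charpoly_of_triangularized matM matMP matMQ matMT (by decide +kernel)
        (by decide +kernel) (by decide +kernel) (by decide +kernel))
    rw [hA]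
    rcases entry_base i j with ⟨h, h'⟩ | ⟨h, h'⟩ <;> simp [h, h']
  · refine charpoly_transfer A' matN (fun i j => ?_)
      (charpoly_of_triangularized matN matNP matNQ matNT (by decide +kernel)
        (by decide +kernel) (by decide +kernel) (by decide +kernel))
    rw [hA']
    rcases entry_mod i j with ⟨h, h'⟩ | ⟨h, h'⟩ <;> simp [h, h']
end
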